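/- arXiv:2201.04457 — 3 statements merged into one kernel-verified Lean document; each statement's English description precedes it below -/
import Mathlib

section
/- In the generalized setting with a directed graph G^V = (V, D_V) and a polynomial parametrization τ of the cone of latent covariance matrices, let ψ(λ, σ) denote the tuple of polynomials given by the entries of (I_d − Λ)^⊤ Σ (I_d − Λ), let I(Im(τ)) ⊆ ℝ[ω] be the vanishing ideal of Im(τ), and set A_S = {h ∘ ψ : h ∈ I(Im(τ))} ⊆ ℝ[λ, σ]. Then ℐ = ⟨A_S ∪ {ξ d(λ) − 1}⟩ ∩ ℝ[λ, σ], where the ideal on the right-hand side is generated in ℝ[λ, σ, ξ]. -/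
open scoped Classical
open Matrix

namespace GenSEM

variable {V : Type*} [Fintype V] [DecidableEq V]

/-- The type of edges of the directed graph `(V, D_V)`. -/
abbrev Edg (DV : Finset (V × V)) : Type _ := {e : V × V // e ∈ DV}

/-- The matrix `Λ` of variables `λ_{ij}` (for `i → j ∈ D_V`), placed in a polynomial
ring with variable index type `α` via `f`. -/
noncomputable def lamMat (DV : Finset (V × V)) {α : Type*} (f : Edg DV → α) :
    Matrix V V (MvPolynomial α ℝ) :=
  Matrix.of fun i j =>
    if h : (i, j) ∈ DV then MvPolynomial.X (f ⟨(i, j), h⟩) else 0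

/-- The polynomial `d(λ) = det(I - Λ)`. -/
noncomputable def dPoly (DV : Finset (V × V)) {α : Type*} (f : Edg DV → α) :
    MvPolynomial α ℝ :=
  (1 - lamMat DV f).det

/-- The matrix of polynomials `φ̃_{ij}(λ, ω)` with
`φ_{ij}(Λ, Ω) = φ̃_{ij}(λ, ω)/d(λ)²`, obtained via the adjugate:
`φ̃ = adj((I-Λ)ᵀ) Ω adj(I-Λ)`. -/
noncomputable def phiTildeMat (DV : Finset (V × V)) {α : Type*} (f : Edg DV → α)
    (Ω : Matrix V V (MvPolynomial α ℝ)) : Matrix V V (MvPolynomial α ℝ) :=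
  ((1 - lamMat DV f)ᵀ).adjugate * Ω * (1 - lamMat DV f).adjugate

/-- A semialgebraic subset of `ℝ^m`: a finite union of sets described by finitely many
polynomial equations and strict polynomial inequalities. -/
def IsSemialgebraic {m : ℕ} (S : Set (Fin m → ℝ)) : Prop :=
  ∃ (k : ℕ) (P Q : Fin k → Finset (MvPolynomial (Fin m) ℝ)),
    S = ⋃ i, {x | (∀ p ∈ P i, MvPolynomial.eval x p = 0) ∧
                  (∀ q ∈ Q i, 0 < MvPolynomial.eval x q)}

/-- The matrix `τ(Δ)` for a polynomial parametrization `τ`. -/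
noncomputable def tauMat {m : ℕ} (τ : V × V → MvPolynomial (Fin m) ℝ)
    (Δ : Fin m → ℝ) : Matrix V V ℝ :=
  Matrix.of fun i j => MvPolynomial.eval Δ (τ (i, j))

/-- The observed covariance matrix `Σ = (I-Λ)^{-⊤} τ(Δ) (I-Λ)^{-1}`. -/
noncomputable def sigmaGen {m : ℕ} (τ : V × V → MvPolynomial (Fin m) ℝ)
    (Λ : Matrix V V ℝ) (Δ : Fin m → ℝ) : Matrix V V ℝ :=
  ((1 - Λ)ᵀ)⁻¹ * tauMat τ Δ * (1 - Λ)⁻¹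

/-- Evaluation of the entries of `Σ`. -/
noncomputable def sigmaGenEval {m : ℕ} (τ : V × V → MvPolynomial (Fin m) ℝ)
    (Λ : Matrix V V ℝ) (Δ : Fin m → ℝ) : V × V → ℝ :=
  fun uw => sigmaGen τ Λ Δ uw.1 uw.2

/-- Variables `λ, σ` of the subring `ℝ[λ, σ]`. -/
abbrev LSVar (DV : Finset (V × V)) : Type _ := Edg DV ⊕ (V × V)

/-- All variables `λ, σ, δ, ξ` of the ring `ℝ[λ, σ, δ, ξ]`. -/
abbrev BigVar (DV : Finset (V × V)) (m : ℕ) : Type _ := LSVar DV ⊕ (Fin m ⊕ Unit)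

/-- The ideal `𝒥 = ⟨{σ_{ij} d(λ)² − φ̃_{ij}(λ, τ(δ))} ∪ {ξ d(λ) − 1}⟩ ⊆ ℝ[λ, σ, δ, ξ]`. -/
noncomputable def Jideal (DV : Finset (V × V)) {m : ℕ}
    (τ : V × V → MvPolynomial (Fin m) ℝ) :
    Ideal (MvPolynomial (BigVar DV m) ℝ) :=
  Ideal.span
    ((Set.range fun ij : V × V =>
        MvPolynomial.X (Sum.inl (Sum.inr ij))
            * dPoly DV (Sum.inl ∘ Sum.inl : Edg DV → BigVar DV m) ^ 2
          - phiTildeMat DV (Sum.inl ∘ Sum.inl : Edg DV → BigVar DV m)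
              (Matrix.of fun i j =>
                MvPolynomial.rename (Sum.inr ∘ Sum.inl : Fin m → BigVar DV m) (τ (i, j)))
              ij.1 ij.2)
      ∪ {MvPolynomial.X (Sum.inr (Sum.inr ()))
           * dPoly DV (Sum.inl ∘ Sum.inl : Edg DV → BigVar DV m) - 1})

/-- The parameter `λ_{ij}` is rationally identifiable in the generalized setting: there
are `a, b ∈ ℝ[σ]` and a nonzero polynomial `g` in the free entries of `(Λ, Δ)` such
that `λ_{ij} = b(Σ)/a(Σ)` whenever `g(Λ, Δ) ≠ 0`. -/
def RatIdentGen (DV : Finset (V × V)) {m : ℕ} (S : Set (Fin m → ℝ))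
    (τ : V × V → MvPolynomial (Fin m) ℝ) (i j : V) : Prop :=
  ∃ (b a : MvPolynomial (V × V) ℝ) (g : MvPolynomial (Edg DV ⊕ Fin m) ℝ),
    g ≠ 0 ∧
    ∀ (Λ : Matrix V V ℝ) (Δ : Fin m → ℝ),
      (∀ u w : V, (u, w) ∉ DV → Λ u w = 0) → IsUnit (1 - Λ) → Δ ∈ S →
      MvPolynomial.eval (Sum.elim (fun e : Edg DV => Λ e.1.1 e.1.2) Δ) g ≠ 0 →
      MvPolynomial.eval (sigmaGenEval τ Λ Δ) a ≠ 0 ∧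
      Λ i j * MvPolynomial.eval (sigmaGenEval τ Λ Δ) a
        = MvPolynomial.eval (sigmaGenEval τ Λ Δ) b

end GenSEM

namespace GenSEM

variable {V : Type*} [Fintype V] [DecidableEq V]

/-- Variables `λ, σ, ξ` of the intermediate ring `ℝ[λ, σ, ξ]`. -/
abbrev MidVar (DV : Finset (V × V)) : Type _ := LSVar DV ⊕ Unit

/-- The matrix of polynomials `ψ(λ, σ) = (I − Λ)ᵀ Σ (I − Λ)` in `ℝ[λ, σ]`. -/
noncomputable def psiMat (DV : Finset (V × V)) :
    Matrix V V (MvPolynomial (LSVar DV) ℝ) :=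
  (1 - lamMat DV (Sum.inl : Edg DV → LSVar DV))ᵀ
    * (Matrix.of fun i j => MvPolynomial.X (Sum.inr (i, j) : LSVar DV))
    * (1 - lamMat DV (Sum.inl : Edg DV → LSVar DV))

/-- The set `A_S = {h ∘ ψ : h ∈ I(Im(τ))} ⊆ ℝ[λ, σ]`, where `I(Im(τ))` is the
vanishing ideal of the cone of latent covariance matrices. -/
def ASet (DV : Finset (V × V)) {m : ℕ} (S : Set (Fin m → ℝ))
    (τ : V × V → MvPolynomial (Fin m) ℝ) : Set (MvPolynomial (LSVar DV) ℝ) :=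
  {g | ∃ h : MvPolynomial (V × V) ℝ,
    (∀ Δ ∈ S, MvPolynomial.eval (fun ij : V × V => tauMat τ Δ ij.1 ij.2) h = 0) ∧
    g = MvPolynomial.aeval (fun ij : V × V => psiMat DV ij.1 ij.2) h}

end GenSEM

namespace GenSEM

open MvPolynomial TensorProduct

section LinearAlgebra

variable {V A B : Type*} [Fintype V] [DecidableEq V] [CommRing A] [CommRing B]

/-- The solution `Σ = x² adj(Mᵀ) Ω adj(M)` of `Mᵀ Σ M = Ω`, where `x` inverts `det M`. -/
def solveSigma (M Ω : Matrix V V A) (x : A) : Matrix V V A :=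
  x ^ 2 • (Mᵀ.adjugate * Ω * M.adjugate)

theorem solveSigma_map (g : A →+* B) (M Ω : Matrix V V A) (x : A) :
    (solveSigma M Ω x).map g = solveSigma (M.map g) (Ω.map g) (g x) := by
  have h : ∀ N : Matrix V V A, N.adjugate.map g = (N.map g).adjugate := g.map_adjugate
  have hs : ∀ N : Matrix V V A, (x ^ 2 • N).map g = g x ^ 2 • N.map g := by
    intro N
    ext i j
    simp
  rw [solveSigma, solveSigma, hs, Matrix.map_mul, Matrix.map_mul, h, h, Matrix.transpose_map]

theorem det_sq_smul_solveSigma {M Ω : Matrix V V A} {x : A} (hx : x * M.det = 1) :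
    M.det ^ 2 • solveSigma M Ω x = Mᵀ.adjugate * Ω * M.adjugate := by
  rw [solveSigma, smul_smul, ← mul_pow, mul_comm, hx, one_pow, one_smul]

theorem solveSigma_transpose_mul_mul {M : Matrix V V A} {x : A} (hx : x * M.det = 1)
    (T : Matrix V V A) : solveSigma M (Mᵀ * T * M) x = T := by
  have h : Mᵀ.adjugate * (Mᵀ * T * M) * M.adjugate = M.det ^ 2 • T := by
    calc _ = (Mᵀ.adjugate * Mᵀ) * T * (M * M.adjugate) := by simp only [Matrix.mul_assoc]
      _ = _ := by
        rw [Matrix.adjugate_mul, Matrix.mul_adjugate, Matrix.det_transpose]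
        simp [smul_smul, sq]
  rw [solveSigma, h, smul_smul, ← mul_pow, hx, one_pow, one_smul]

theorem transpose_mul_mul_eq_of_det_sq_smul_eq {M T Ω : Matrix V V A} {x : A}
    (hx : x * M.det = 1) (h : M.det ^ 2 • T = Mᵀ.adjugate * Ω * M.adjugate) :
    Mᵀ * T * M = Ω := by
  have hM : M.det ^ 2 • (Mᵀ * T * M) = M.det ^ 2 • Ω := by
    calc _ = Mᵀ * (M.det ^ 2 • T) * M := by simp
      _ = (Mᵀ * Mᵀ.adjugate) * Ω * (M.adjugate * M) := by
        rw [h]; simp only [Matrix.mul_assoc]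
      _ = _ := by
        rw [Matrix.adjugate_mul, Matrix.mul_adjugate, Matrix.det_transpose]
        simp [smul_smul, sq]
  have := congrArg (x ^ 2 • ·) hM
  simpa only [smul_smul, ← mul_pow, hx, one_pow, one_smul] using this

end LinearAlgebra

/-- Elements of `C ⊗ ker w` are killed by every algebra map out of `C ⊗ P` that kills `ker w`;
by flatness of `C` over a field, these are all the elements of the kernel of `C ⊗ w`. -/
theorem productMap_eq_zero_of_map_eq_zero {K C P R Q : Type*} [Field K] [CommRing C]
    [CommRing P] [CommRing R] [CommRing Q] [Algebra K C] [Algebra K P] [Algebra K R]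
    [Algebra K Q] (u : C →ₐ[K] Q) (v : P →ₐ[K] Q) (w : P →ₐ[K] R)
    (hv : ∀ p, w p = 0 → v p = 0) {t : C ⊗[K] P}
    (ht : Algebra.TensorProduct.map (AlgHom.id K C) w t = 0) :
    Algebra.TensorProduct.productMap u v t = 0 := by
  have hex : Function.Exact (LinearMap.ker w.toLinearMap).subtype w.toLinearMap := fun p =>
    ⟨fun h => ⟨⟨p, h⟩, rfl⟩, fun ⟨q, hq⟩ => hq ▸ q.2⟩
  obtain ⟨s, rfl⟩ := (Module.Flat.lTensor_exact C hex t).1 ht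
  have hz : (Algebra.TensorProduct.productMap u v).toLinearMap ∘ₗ
      (LinearMap.ker w.toLinearMap).subtype.lTensor C = 0 := by
    refine TensorProduct.ext' fun c p => ?_
    have hp : v p.1 = 0 := hv _ p.2
    simp [hp]
  exact LinearMap.congr_fun hz s

theorem eq_zero_of_eval_eq_zero_on_isOpen {ι : Type*} [Finite ι] {S : Set (ι → ℝ)}
    (hS : S.Nonempty) (hSo : IsOpen S) {p : MvPolynomial ι ℝ}
    (hp : ∀ x ∈ S, eval x p = 0) : p = 0 := by
  obtain ⟨a, ha⟩ := hS
  obtain ⟨U, hU, hUS⟩ := isOpen_pi_iff'.1 hSo a ha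
  refine funext_set U (fun i => infinite_of_mem_nhds (a i) ((hU i).1.mem_nhds (hU i).2)) ?_
  intro x hx
  rw [hp x (hUS hx), map_zero]

section Edges

variable {V A B α : Type*} [DecidableEq V] [CommRing A] [CommRing B] {DV : Finset (V × V)}

/-- The matrix `I - Λ` for `Λ` with prescribed entries along the edges. -/
noncomputable def oneSubEdgeMat (a : Edg DV → A) : Matrix V V A :=
  1 - Matrix.of fun i j => if h : (i, j) ∈ DV then a ⟨(i, j), h⟩ else 0

theorem oneSubEdgeMat_map (g : A →+* B) (a : Edg DV → A) :
    (oneSubEdgeMat a).map g = oneSubEdgeMat (g ∘ a) := by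
  ext i j
  by_cases h : (i, j) ∈ DV <;> simp [oneSubEdgeMat, h, Matrix.one_apply, apply_ite g]

theorem one_sub_lamMat (f : Edg DV → α) :
    1 - lamMat DV f = oneSubEdgeMat fun e => (X (f e) : MvPolynomial α ℝ) := rfl

variable [Fintype V]

theorem map_dPoly (g : MvPolynomial α ℝ →+* B) (f : Edg DV → α) :
    g (dPoly DV f) = (oneSubEdgeMat fun e => g (X (f e))).det := by
  rw [dPoly, one_sub_lamMat, RingHom.map_det, RingHom.mapMatrix_apply, oneSubEdgeMat_map]
  rfl

theorem map_phiTildeMat (g : MvPolynomial α ℝ →+* B) (f : Edg DV → α)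
    (Ω : Matrix V V (MvPolynomial α ℝ)) :
    (phiTildeMat DV f Ω).map g =
      (oneSubEdgeMat fun e => g (X (f e)))ᵀ.adjugate * Ω.map g *
        (oneSubEdgeMat fun e => g (X (f e))).adjugate := by
  have h : ∀ N : Matrix V V (MvPolynomial α ℝ), N.adjugate.map g = (N.map g).adjugate :=
    g.map_adjugate
  rw [phiTildeMat, Matrix.map_mul, Matrix.map_mul, h, h, Matrix.transpose_map, one_sub_lamMat,
    oneSubEdgeMat_map]
  rfl

theorem map_psiMat (g : MvPolynomial (LSVar DV) ℝ →+* B) :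
    (psiMat DV).map g =
      (oneSubEdgeMat fun e => g (X (Sum.inl e)))ᵀ *
        (Matrix.of fun i j => g (X (Sum.inr (i, j)))) *
        oneSubEdgeMat fun e => g (X (Sum.inl e)) := by
  rw [psiMat, Matrix.map_mul, Matrix.map_mul, Matrix.transpose_map, one_sub_lamMat,
    oneSubEdgeMat_map]
  rfl

variable [Algebra ℝ A] {m : ℕ} {τ : V × V → MvPolynomial (Fin m) ℝ}

theorem map_aeval_solveSigma [Algebra ℝ B] (g : A →ₐ[ℝ] B) (a : Edg DV → A)
    (Ω : Matrix V V A) (x : A) (f : MvPolynomial (LSVar DV) ℝ) :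
    g (aeval (Sum.elim a fun ij => solveSigma (oneSubEdgeMat a) Ω x ij.1 ij.2) f) =
      aeval (Sum.elim (g ∘ a) fun ij =>
        solveSigma (oneSubEdgeMat (g ∘ a)) (Ω.map g) (g x) ij.1 ij.2) f := by
  have h := solveSigma_map g.toRingHom (oneSubEdgeMat a) Ω x
  rw [oneSubEdgeMat_map] at h
  rw [← AlgHom.comp_apply, comp_aeval]
  congr 2
  ext (e | ij)
  · rfl
  · exact congrFun (congrFun h ij.1) ij.2

/-- Membership in `𝒥` forces vanishing at all points, in any `ℝ`-algebra, of the solution set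
of the equations generating `𝒥`. -/
theorem aeval_eq_zero_of_rename_mem_Jideal {f : MvPolynomial (LSVar DV) ℝ}
    (hf : rename (Sum.inl : LSVar DV → BigVar DV m) f ∈ Jideal DV τ)
    (a : Edg DV → A) (T : Matrix V V A) (δ : Fin m → A) {x : A}
    (hx : x * (oneSubEdgeMat a).det = 1)
    (hT : (oneSubEdgeMat a).det ^ 2 • T = (oneSubEdgeMat a)ᵀ.adjugate *
      (Matrix.of fun i j => aeval δ (τ (i, j))) * (oneSubEdgeMat a).adjugate) :
    aeval (Sum.elim a fun ij => T ij.1 ij.2) f = 0 := by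
  set g : MvPolynomial (BigVar DV m) ℝ →ₐ[ℝ] A :=
    aeval (Sum.elim (Sum.elim a fun ij => T ij.1 ij.2) (Sum.elim δ fun _ => x)) with hg
  have hd : g (dPoly DV (Sum.inl ∘ Sum.inl : Edg DV → BigVar DV m)) = (oneSubEdgeMat a).det := by
    have := map_dPoly g.toRingHom (Sum.inl ∘ Sum.inl : Edg DV → BigVar DV m)
    simpa [hg] using this
  have hJ : Jideal DV τ ≤ RingHom.ker g.toRingHom := by
    refine Ideal.span_le.2 ?_
    rintro _ (⟨⟨i, j⟩, rfl⟩ | rfl)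
    · have h1 := map_phiTildeMat g.toRingHom (Sum.inl ∘ Sum.inl : Edg DV → BigVar DV m)
        (Matrix.of fun i j => rename (Sum.inr ∘ Sum.inl : Fin m → BigVar DV m) (τ (i, j)))
      have h2 : (Matrix.of fun i j => rename (Sum.inr ∘ Sum.inl : Fin m → BigVar DV m)
          (τ (i, j)) : Matrix V V _).map g.toRingHom =
          Matrix.of fun i j => aeval δ (τ (i, j)) := by
        ext i j
        simp only [hg, Matrix.map_apply, Matrix.of_apply, AlgHom.toRingHom_eq_coe,
          RingHom.coe_coe, aeval_rename]
        rfl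
      have h3 : (fun e => g.toRingHom (X ((Sum.inl ∘ Sum.inl : Edg DV → BigVar DV m) e))) = a := by
        ext e
        simp [hg]
      rw [h2, h3, ← hT] at h1
      have h4 := congrFun (congrFun h1 i) j
      have h5 : g (X (Sum.inl (Sum.inr (i, j)))) = T i j := by simp [hg]
      simp only [Matrix.map_apply, AlgHom.toRingHom_eq_coe, RingHom.coe_coe, Matrix.smul_apply,
        smul_eq_mul] at h4
      simp only [SetLike.mem_coe, RingHom.mem_ker, AlgHom.toRingHom_eq_coe, RingHom.coe_coe,
        map_sub, map_mul, map_pow, hd, h4, h5]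
      ring
    · have h5 : g (X (Sum.inr (Sum.inr ()))) = x := by simp [hg]
      simp only [SetLike.mem_coe, RingHom.mem_ker, AlgHom.toRingHom_eq_coe, RingHom.coe_coe,
        map_sub, map_mul, map_one, hd, h5, hx, sub_self]
  have h0 : g (rename Sum.inl f) = 0 := hJ hf
  rw [hg, aeval_rename] at h0
  exact h0

end Edges

/-- The vanishing ideal of `Im(τ)` is the kernel of `ω ↦ τ(δ)`. -/
theorem aeval_tau_eq_zero_iff {V : Type*} {m : ℕ} {S : Set (Fin m → ℝ)}
    {τ : V × V → MvPolynomial (Fin m) ℝ} (hS : S.Nonempty) (hSo : IsOpen S)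
    (h : MvPolynomial (V × V) ℝ) :
    aeval τ h = 0 ↔ ∀ Δ ∈ S, eval (fun ij : V × V => tauMat τ Δ ij.1 ij.2) h = 0 := by
  have key : ∀ Δ, eval Δ (aeval τ h) = eval (fun ij : V × V => tauMat τ Δ ij.1 ij.2) h := by
    intro Δ
    have := congrArg (fun φ => φ h) (MvPolynomial.comp_aeval τ (aeval Δ : _ →ₐ[ℝ] ℝ))
    simpa [tauMat, aeval_eq_eval] using this
  refine ⟨fun h0 Δ _ => ?_, fun h0 => eq_zero_of_eval_eq_zero_on_isOpen hS hSo fun Δ hΔ => ?_⟩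
  · rw [← key, h0, map_zero]
  · rw [key, h0 Δ hΔ]

section Ideals

variable {V : Type*} [Fintype V] [DecidableEq V] {DV : Finset (V × V)} {m : ℕ}
  {τ : V × V → MvPolynomial (Fin m) ℝ}

/-- If `h ∘ τ = 0`, then `h ∘ ψ` lies in `𝒥`. -/
theorem rename_aeval_psiMat_mem_Jideal {h : MvPolynomial (V × V) ℝ} (hh : aeval τ h = 0) :
    rename (Sum.inl : LSVar DV → BigVar DV m)
      (aeval (fun ij : V × V => psiMat DV ij.1 ij.2) h) ∈ Jideal DV τ := by
  set J := Jideal DV τ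
  set q := Ideal.Quotient.mkₐ ℝ J
  set g : MvPolynomial (LSVar DV) ℝ →ₐ[ℝ] _ :=
    q.comp (rename (Sum.inl : LSVar DV → BigVar DV m)) with hg
  set a : Edg DV → MvPolynomial (BigVar DV m) ℝ ⧸ J := fun e => q (X (Sum.inl (Sum.inl e)))
  have hd : q (dPoly DV (Sum.inl ∘ Sum.inl : Edg DV → BigVar DV m)) = (oneSubEdgeMat a).det :=
    map_dPoly q.toRingHom _
  have hx : q (X (Sum.inr (Sum.inr ()))) * (oneSubEdgeMat a).det = 1 := by
    rw [← hd, ← map_mul, ← sub_eq_zero, ← map_one q, ← map_sub]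
    exact Ideal.Quotient.eq_zero_iff_mem.2 (Ideal.subset_span (Or.inr rfl))
  set Ω : Matrix V V (MvPolynomial (BigVar DV m) ℝ) := Matrix.of fun i j =>
    rename (Sum.inr ∘ Sum.inl : Fin m → BigVar DV m) (τ (i, j)) with hΩ
  have hT : (oneSubEdgeMat a).det ^ 2 •
      (Matrix.of fun i j => q (X (Sum.inl (Sum.inr (i, j))))) =
      (oneSubEdgeMat a)ᵀ.adjugate * Ω.map q * (oneSubEdgeMat a).adjugate := by
    refine Eq.trans ?_ (map_phiTildeMat q.toRingHom
      (Sum.inl ∘ Sum.inl : Edg DV → BigVar DV m) Ω)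
    ext i j
    have : q (X (Sum.inl (Sum.inr (i, j)))
        * dPoly DV (Sum.inl ∘ Sum.inl : Edg DV → BigVar DV m) ^ 2
        - phiTildeMat DV (Sum.inl ∘ Sum.inl : Edg DV → BigVar DV m) Ω i j) = 0 :=
      Ideal.Quotient.eq_zero_iff_mem.2 (Ideal.subset_span (Or.inl ⟨(i, j), rfl⟩))
    rw [map_sub, map_mul, map_pow, hd, sub_eq_zero] at this
    simpa [mul_comm] using this
  have hψ : (psiMat DV).map g = Ω.map q := by
    refine (map_psiMat g.toRingHom).trans ?_
    rw [← transpose_mul_mul_eq_of_det_sq_smul_eq hx hT]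
    simp [hg, a]
  have hcomp : g (aeval (fun ij : V × V => psiMat DV ij.1 ij.2) h) =
      q (rename (Sum.inr ∘ Sum.inl) (aeval τ h)) := by
    have : g.comp (aeval fun ij : V × V => psiMat DV ij.1 ij.2) =
        (q.comp (rename (Sum.inr ∘ Sum.inl : Fin m → BigVar DV m))).comp (aeval τ) := by
      ext ij
      simpa [hΩ] using congrFun (congrFun hψ ij.1) ij.2
    exact AlgHom.congr_fun this h
  refine Ideal.Quotient.eq_zero_iff_mem.1 (hcomp.trans ?_)
  rw [hh, map_zero, map_zero]

/-- The version of `aeval_eq_zero_of_psi_vanishing` in which the values of `λ` and of the inverse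
of `d(λ)` are images of elements `c` and `y` of a given `ℝ`-algebra `C`. -/
theorem aeval_eq_zero_of_psi_vanishing_of_algHom {C Q : Type*} [CommRing C] [Algebra ℝ C]
    [CommRing Q] [Algebra ℝ Q] {f : MvPolynomial (LSVar DV) ℝ}
    (hf : rename (Sum.inl : LSVar DV → BigVar DV m) f ∈ Jideal DV τ)
    (u : C →ₐ[ℝ] Q) (c : Edg DV → C) {y : C} (hy : y * (oneSubEdgeMat c).det = 1)
    {a : Edg DV → Q} (huc : ∀ e, u (c e) = a e) (T : Matrix V V Q)
    (hψ : ∀ h : MvPolynomial (V × V) ℝ, aeval τ h = 0 →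
      aeval (fun ij : V × V => ((oneSubEdgeMat a)ᵀ * T * oneSubEdgeMat a) ij.1 ij.2) h = 0) :
    aeval (Sum.elim a fun ij => T ij.1 ij.2) f = 0 := by
  have hx : u y * (oneSubEdgeMat a).det = 1 := by
    have h := congrArg u hy
    rw [map_mul, map_one, AlgHom.map_det] at h
    rw [← funext huc]
    refine Eq.trans ?_ h
    exact congrArg (fun N : Matrix V V Q => u y * N.det) (oneSubEdgeMat_map u.toRingHom c).symm
  let v : MvPolynomial (V × V) ℝ →ₐ[ℝ] Q :=
    aeval fun ij : V × V => ((oneSubEdgeMat a)ᵀ * T * oneSubEdgeMat a) ij.1 ij.2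
  let s : Matrix V V (C ⊗[ℝ] MvPolynomial (V × V) ℝ) := Matrix.of fun i j => 1 ⊗ₜ X (i, j)
  let cs : Edg DV → C ⊗[ℝ] MvPolynomial (V × V) ℝ := fun e => c e ⊗ₜ 1
  have hker : Algebra.TensorProduct.map (AlgHom.id ℝ C) (aeval τ)
      (aeval (Sum.elim cs fun ij => solveSigma (oneSubEdgeMat cs) s (y ⊗ₜ 1) ij.1 ij.2) f) = 0 := by
    rw [map_aeval_solveSigma]
    have hdet : (y ⊗ₜ[ℝ] (1 : MvPolynomial (Fin m) ℝ)) *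
        (oneSubEdgeMat fun e => c e ⊗ₜ[ℝ] (1 : MvPolynomial (Fin m) ℝ)).det = 1 := by
      have := congrArg (Algebra.TensorProduct.includeLeftRingHom :
        C →+* C ⊗[ℝ] MvPolynomial (Fin m) ℝ) hy
      rw [map_mul, map_one, RingHom.map_det, RingHom.mapMatrix_apply, oneSubEdgeMat_map] at this
      exact this
    have hcs : (Algebra.TensorProduct.map (AlgHom.id ℝ C) (aeval τ) ∘ cs) =
        fun e => c e ⊗ₜ[ℝ] (1 : MvPolynomial (Fin m) ℝ) := by
      ext e
      simp [cs]
    have hs : s.map (Algebra.TensorProduct.map (AlgHom.id ℝ C) (aeval τ)) =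
        Matrix.of fun i j => aeval (fun k => (1 : C) ⊗ₜ[ℝ] (X k : MvPolynomial (Fin m) ℝ))
          (τ (i, j)) := by
      ext i j
      have h1 : (aeval fun k => (1 : C) ⊗ₜ[ℝ] (X k : MvPolynomial (Fin m) ℝ)) =
          (Algebra.TensorProduct.includeRight :
            MvPolynomial (Fin m) ℝ →ₐ[ℝ] C ⊗[ℝ] MvPolynomial (Fin m) ℝ) := by
        ext k
        simp
      simp [s, h1]
    rw [hcs, hs, Algebra.TensorProduct.map_tmul, map_one, AlgHom.id_apply]
    exact aeval_eq_zero_of_rename_mem_Jideal hf _ _ _ hdet (det_sq_smul_solveSigma hdet)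
  have h0 := productMap_eq_zero_of_map_eq_zero u v (aeval τ) hψ hker
  have hcs : Algebra.TensorProduct.productMap u v ∘ cs = a := by
    ext e
    simp [cs, huc]
  have hs : s.map (Algebra.TensorProduct.productMap u v) =
      (oneSubEdgeMat a)ᵀ * T * oneSubEdgeMat a := by
    ext i j
    simp [s, v]
  rw [map_aeval_solveSigma, hcs, hs, Algebra.TensorProduct.productMap_apply_tmul, map_one,
    mul_one, solveSigma_transpose_mul_mul hx] at h0
  exact h0

/-- In an `ℝ`-algebra `Q` with a point `(λ, Σ)`, `d(λ)` invertible, at which `h ∘ ψ` vanishes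
whenever `h ∘ τ = 0`, every polynomial of `𝒥 ∩ ℝ[λ, σ]` vanishes at that point. -/
theorem aeval_eq_zero_of_psi_vanishing {Q : Type*} [CommRing Q] [Algebra ℝ Q]
    {f : MvPolynomial (LSVar DV) ℝ}
    (hf : rename (Sum.inl : LSVar DV → BigVar DV m) f ∈ Jideal DV τ)
    (a : Edg DV → Q) (T : Matrix V V Q) {x : Q} (hx : x * (oneSubEdgeMat a).det = 1)
    (hψ : ∀ h : MvPolynomial (V × V) ℝ, aeval τ h = 0 →
      aeval (fun ij : V × V => ((oneSubEdgeMat a)ᵀ * T * oneSubEdgeMat a) ij.1 ij.2) h = 0) :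
    aeval (Sum.elim a fun ij => T ij.1 ij.2) f = 0 := by
  let I : Ideal (MvPolynomial (Edg DV ⊕ Unit) ℝ) :=
    Ideal.span {X (Sum.inr ()) * dPoly DV Sum.inl - 1}
  let C := MvPolynomial (Edg DV ⊕ Unit) ℝ ⧸ I
  let mk : MvPolynomial (Edg DV ⊕ Unit) ℝ →ₐ[ℝ] C := Ideal.Quotient.mkₐ ℝ I
  let u : C →ₐ[ℝ] Q := Ideal.Quotient.liftₐ I (aeval (Sum.elim a fun _ => x)) (by
    intro p hp
    have hI : I ≤ RingHom.ker (aeval (Sum.elim a fun _ => x) :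
        MvPolynomial (Edg DV ⊕ Unit) ℝ →ₐ[ℝ] Q).toRingHom := by
      refine Ideal.span_le.2 ?_
      rintro _ rfl
      have hd := map_dPoly (aeval (Sum.elim a fun _ => x) :
        MvPolynomial (Edg DV ⊕ Unit) ℝ →ₐ[ℝ] Q).toRingHom (Sum.inl : Edg DV → Edg DV ⊕ Unit)
      simp only [AlgHom.toRingHom_eq_coe, RingHom.coe_coe, aeval_X, Sum.elim_inl] at hd
      simp [hd, hx]
    exact hI hp)
  let c : Edg DV → C := fun e => mk (X (Sum.inl e))
  let y : C := mk (X (Sum.inr ()))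
  have hy : y * (oneSubEdgeMat c).det = 1 := by
    have hd : mk (dPoly DV Sum.inl) = (oneSubEdgeMat c).det := map_dPoly mk.toRingHom _
    rw [← hd, ← map_mul, ← sub_eq_zero, ← map_one mk, ← map_sub]
    exact Ideal.Quotient.eq_zero_iff_mem.2 (Ideal.subset_span rfl)
  exact aeval_eq_zero_of_psi_vanishing_of_algHom hf u c hy (fun e =>
    (aeval_X (R := ℝ) (Sum.elim a fun _ => x) (Sum.inl e) :)) T hψ

end Ideals

end GenSEM

open GenSEM
open MvPolynomial (X rename eval aeval rename_X rename_rename comp_aeval)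

/-- **Proposition 14: `ℐ = ⟨A_S, ξ d(λ) − 1⟩ ∩ ℝ[λ, σ]`.**
A polynomial `f ∈ ℝ[λ, σ]` lies in `ℐ = 𝒥 ∩ ℝ[λ, σ]` if and only if it lies in the
ideal generated by `A_S ∪ {ξ d(λ) − 1}` in `ℝ[λ, σ, ξ]`, intersected with `ℝ[λ, σ]`. -/
theorem ideal_I_eq_span_AS
    {V : Type} [Fintype V] [DecidableEq V]
    (DV : Finset (V × V)) (hloop : ∀ x : V, (x, x) ∉ DV)
    (m : ℕ) (S : Set (Fin m → ℝ))
    (hSne : S.Nonempty) (hSopen : IsOpen S) (hSsemi : IsSemialgebraic S)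
    (τ : V × V → MvPolynomial (Fin m) ℝ)
    (hτsym : ∀ i j : V, τ (i, j) = τ (j, i))
    (hτpd : ∀ Δ ∈ S, (tauMat τ Δ).PosDef)
    (f : MvPolynomial (LSVar DV) ℝ) :
    MvPolynomial.rename (Sum.inl : LSVar DV → BigVar DV m) f ∈ Jideal DV τ ↔
    MvPolynomial.rename (Sum.inl : LSVar DV → MidVar DV) f ∈
      Ideal.span
        ((MvPolynomial.rename (Sum.inl : LSVar DV → MidVar DV) '' ASet DV S τ)
          ∪ {MvPolynomial.X (Sum.inr () : MidVar DV)
               * MvPolynomial.rename (Sum.inl : LSVar DV → MidVar DV)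
                   (dPoly DV (Sum.inl : Edg DV → LSVar DV)) - 1}) := by
  set K := Ideal.span
    ((rename (Sum.inl : LSVar DV → MidVar DV) '' ASet DV S τ)
      ∪ {X (Sum.inr () : MidVar DV)
           * rename (Sum.inl : LSVar DV → MidVar DV)
               (dPoly DV (Sum.inl : Edg DV → LSVar DV)) - 1})
  have hA : ∀ h : MvPolynomial (V × V) ℝ,
      (∀ Δ ∈ S, eval (fun ij : V × V => tauMat τ Δ ij.1 ij.2) h = 0) ↔ aeval τ h = 0 :=
    fun h => (aeval_tau_eq_zero_iff hSne hSopen h).symm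
  constructor
  · intro hf
    let q : MvPolynomial (LSVar DV) ℝ →ₐ[ℝ] MvPolynomial (MidVar DV) ℝ ⧸ K :=
      (Ideal.Quotient.mkₐ ℝ K).comp (rename Sum.inl)
    have hx : Ideal.Quotient.mkₐ ℝ K (X (Sum.inr ())) *
        (oneSubEdgeMat fun e => q (X (Sum.inl e))).det = 1 := by
      have hd : q (dPoly DV Sum.inl) = (oneSubEdgeMat fun e => q (X (Sum.inl e))).det :=
        map_dPoly q.toRingHom _
      rw [← hd, AlgHom.comp_apply, ← map_mul, ← sub_eq_zero,
        ← map_one (Ideal.Quotient.mkₐ ℝ K), ← map_sub]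
      exact Ideal.Quotient.eq_zero_iff_mem.2 (Ideal.subset_span (Or.inr rfl))
    have h0 := aeval_eq_zero_of_psi_vanishing hf (fun e => q (X (Sum.inl e)))
      (Matrix.of fun i j => q (X (Sum.inr (i, j)))) hx (by
        intro h hh
        have hψ : (psiMat DV).map q = _ := map_psiMat q.toRingHom
        have hq : q (aeval (fun ij : V × V => psiMat DV ij.1 ij.2) h) = 0 :=
          Ideal.Quotient.eq_zero_iff_mem.2
            (Ideal.subset_span (Or.inl ⟨_, ⟨h, (hA h).2 hh, rfl⟩, rfl⟩))
        rw [← AlgHom.comp_apply, comp_aeval] at hq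
        refine Eq.trans ?_ hq
        congr 2
        ext ij
        exact (congrFun (congrFun hψ ij.1) ij.2).symm)
    have hq : aeval (Sum.elim (fun e => q (X (Sum.inl e))) fun ij : V × V =>
        (Matrix.of fun i j => q (X (Sum.inr (i, j)))) ij.1 ij.2) = q := by
      ext (e | ij) <;> simp
    rw [hq] at h0
    exact Ideal.Quotient.eq_zero_iff_mem.1 h0
  · intro hf
    let r : MvPolynomial (MidVar DV) ℝ →ₐ[ℝ] MvPolynomial (BigVar DV m) ℝ :=
      rename (Sum.map id Sum.inr)
    have hr : ∀ p : MvPolynomial (LSVar DV) ℝ, r (rename Sum.inl p) = rename Sum.inl p :=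
      fun p => rename_rename ..
    have hKJ : K ≤ (Jideal DV τ).comap r := by
      refine Ideal.span_le.2 ?_
      rintro _ (⟨_, ⟨h, hh, rfl⟩, rfl⟩ | rfl)
      · rw [SetLike.mem_coe, Ideal.mem_comap, hr]
        exact rename_aeval_psiMat_mem_Jideal ((hA h).1 hh)
      · have hd : rename (Sum.inl : LSVar DV → BigVar DV m) (dPoly DV Sum.inl) =
            dPoly DV (Sum.inl ∘ Sum.inl) := by
          refine (map_dPoly (rename (Sum.inl : LSVar DV → BigVar DV m)).toRingHom _).trans ?_
          simp [dPoly, one_sub_lamMat]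
        rw [SetLike.mem_coe, Ideal.mem_comap, map_sub, map_mul, hr, hd, map_one, rename_X]
        exact Ideal.subset_span (Or.inr rfl)
    rw [← hr]
    exact hKJ hf
end

section
/- Let G = (V ∪ ℒ, D) be a latent-factor graph, let v ∈ V, and let Y, Z ⊆ V∖{v} and H ⊆ ℒ with |H| = |Z| be such that Y ∩ (Z ∪ {v}) = ∅ and pa_ℒ(Y) ∩ pa_ℒ(Z ∪ {v}) ⊆ H. Then for all Γ ∈ ℝ^{D_{ℒV}} and all Ω_diag ∈ diag⁺_d, the latent covariance matrix Ω = Ω_diag + Γ^⊤Γ satisfies Ω_{Y, Z∪{v}} = Σ_{h ∈ H} (Γ_h^⊤ Γ_h)_{Y, Z∪{v}}, and in particular rank(Ω_{Y, Z∪{v}}) ≤ |H| = |Z|, so the submatrix Ω_{Y, Z∪{v}} does not have full column rank. -/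
open scoped Classical
open Matrix

namespace LFG

variable {V L : Type*} [DecidableEq V] [DecidableEq L]

/-- Observed parents of a node `v`: nodes `w` with `w → v` in `D_V`. -/
def paV (DV : Finset (V × V)) (v : V) : Finset V :=
  (DV.filter fun e => e.2 = v).image Prod.fst

/-- Latent parents of a set `W` of observed nodes. -/
def paL (DLV : Finset (L × V)) (W : Finset V) : Finset L :=
  (DLV.filter fun e => e.2 ∈ W).image Prod.fst

/-- Observed children of a set `H` of latent nodes. -/
def chL (DLV : Finset (L × V)) (H : Finset L) : Finset V :=
  (DLV.filter fun e => e.1 ∈ H).image Prod.snd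

/-- A latent-factor half-trek: either a directed path
`source → x₁ → ⋯ → xₙ → target` (when `latent = none`, with node list
`source :: tail`), or `source ← h → x₁ → ⋯ → xₙ → target`
(when `latent = some h`, with observed node list `tail ≠ []`).
Trivial half-treks (`latent = none`, `tail = []`) are allowed. -/
structure HalfTrek (DV : Finset (V × V)) (DLV : Finset (L × V)) where
  source : V
  latent : Option L
  tail : List V
  chain : List.Chain' (fun a b => (a, b) ∈ DV) tail
  src_edge : latent = none → ∀ x ∈ tail.head?, (source, x) ∈ DV
  latent_src : ∀ h, latent = some h → (h, source) ∈ DLV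
  latent_head : ∀ h, latent = some h → ∃ x, tail.head? = some x ∧ (h, x) ∈ DLV

variable {DV : Finset (V × V)} {DLV : Finset (L × V)}

/-- The target of a half-trek. -/
def HalfTrek.target (t : HalfTrek DV DLV) : V := t.tail.getLastD t.source

/-- Observed part of the left-hand side of a half-trek. -/
def HalfTrek.leftV (t : HalfTrek DV DLV) : Finset V := {t.source}

/-- Latent node of a half-trek (both on its left- and right-hand side). -/
def HalfTrek.lats (t : HalfTrek DV DLV) : Finset L := t.latent.toFinset

/-- Observed part of the right-hand side of a half-trek. -/
def HalfTrek.rightV (t : HalfTrek DV DLV) : Finset V :=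
  match t.latent with
  | none => insert t.source t.tail.toFinset
  | some _ => t.tail.toFinset

/-- The half-trek avoids all latent nodes in `H`. -/
def HalfTrek.Avoids (t : HalfTrek DV DLV) (H : Finset L) : Prop :=
  ∀ h, t.latent = some h → h ∉ H

/-- `w` is half-trek reachable from `u` while avoiding `H` (for distinct `u ≠ w`). -/
def HtrFrom (DV : Finset (V × V)) (DLV : Finset (L × V)) (H : Finset L) (u w : V) : Prop :=
  u ≠ w ∧ ∃ t : HalfTrek DV DLV, t.source = u ∧ t.target = w ∧ t.Avoids H

/-- `w ∈ htr_H(U)`. -/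
def HtrReach (DV : Finset (V × V)) (DLV : Finset (L × V)) (H : Finset L)
    (U : Finset V) (w : V) : Prop :=
  ∃ u ∈ U, HtrFrom DV DLV H u w

/-- Two half-treks have no sided intersection. -/
def NSI (t₁ t₂ : HalfTrek DV DLV) : Prop :=
  Disjoint t₁.leftV t₂.leftV ∧ Disjoint t₁.lats t₂.lats ∧ Disjoint t₁.rightV t₂.rightV

/-- A system of latent-factor half-treks with no sided intersection from `Y` to `T`,
indexed by targets. -/
def IsHTSystem (DV : Finset (V × V)) (DLV : Finset (L × V)) (Y T : Finset V)
    (f : V → HalfTrek DV DLV) : Prop :=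
  (∀ b ∈ T, (f b).target = b) ∧
  T.image (fun b => (f b).source) = Y ∧
  ∀ b₁ ∈ T, ∀ b₂ ∈ T, b₁ ≠ b₂ → NSI (f b₁) (f b₂)

/-- The triple `(Y, Z, H)` satisfies the latent-factor half-trek criterion (LF-HTC)
with respect to `v`. -/
def SatisfiesLFHTC (DV : Finset (V × V)) (DLV : Finset (L × V)) (v : V)
    (Y Z : Finset V) (H : Finset L) : Prop :=
  v ∉ Y ∧ v ∉ Z ∧
  Y.card = (paV DV v).card + H.card ∧
  Z.card = H.card ∧
  Disjoint Z (paV DV v) ∧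
  Disjoint Y (insert v Z) ∧
  (paL DLV Y ∩ paL DLV (insert v Z) ⊆ H) ∧
  ∃ f : V → HalfTrek DV DLV,
    IsHTSystem DV DLV Y (Z ∪ paV DV v) f ∧
    ∀ z ∈ Z, ∃ h ∈ H, (f z).latent = some h ∧ (f z).tail = [z]

section Matrices

variable [Fintype V] [Fintype L]

/-- The observed covariance matrix `Σ = (I-Λ)^{-⊤} (Ω_diag + Γ^⊤Γ) (I-Λ)^{-1}`. -/
noncomputable def SigmaMat (Λ : Matrix V V ℝ) (Γ : Matrix L V ℝ) (ω : V → ℝ) :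
    Matrix V V ℝ :=
  ((1 - Λ)ᵀ)⁻¹ * (Matrix.diagonal ω + Γᵀ * Γ) * (1 - Λ)⁻¹

/-- The parameters `(Λ, Γ, Ω_diag)` belong to `ℝ^{D_V}_reg × ℝ^{D_{ℒV}} × diag⁺_d`. -/
def GoodParams (DV : Finset (V × V)) (DLV : Finset (L × V))
    (Λ : Matrix V V ℝ) (Γ : Matrix L V ℝ) (ω : V → ℝ) : Prop :=
  (∀ a b : V, (a, b) ∉ DV → Λ a b = 0) ∧
  IsUnit (1 - Λ) ∧
  (∀ h a, (h, a) ∉ DLV → Γ h a = 0) ∧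
  (∀ a, 0 < ω a)

/-- Index type for the free parameter coordinates of `(Λ, Γ, Ω_diag)`. -/
abbrev ParamVar (DV : Finset (V × V)) (DLV : Finset (L × V)) : Type _ :=
  {e : V × V // e ∈ DV} ⊕ {e : L × V // e ∈ DLV} ⊕ V

/-- Evaluation of the parameter coordinates. -/
def evalParam (DV : Finset (V × V)) (DLV : Finset (L × V))
    (Λ : Matrix V V ℝ) (Γ : Matrix L V ℝ) (ω : V → ℝ) : ParamVar DV DLV → ℝ
  | Sum.inl e => Λ e.1.1 e.1.2
  | Sum.inr (Sum.inl e) => Γ e.1.1 e.1.2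
  | Sum.inr (Sum.inr a) => ω a

/-- Evaluation of the entries of `Σ`. -/
noncomputable def sigmaEval (Λ : Matrix V V ℝ) (Γ : Matrix L V ℝ) (ω : V → ℝ) :
    V × V → ℝ := fun e => SigmaMat Λ Γ ω e.1 e.2

/-- The direct effect `λ_{wv}` (the edge `w → v`) is rationally identifiable. -/
def RatIdent (DV : Finset (V × V)) (DLV : Finset (L × V)) (w v : V) : Prop :=
  ∃ (p q : MvPolynomial (V × V) ℝ) (g : MvPolynomial (ParamVar DV DLV) ℝ),
    g ≠ 0 ∧
    ∀ (Λ : Matrix V V ℝ) (Γ : Matrix L V ℝ) (ω : V → ℝ),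
      GoodParams DV DLV Λ Γ ω →
      MvPolynomial.eval (evalParam DV DLV Λ Γ ω) g ≠ 0 →
      MvPolynomial.eval (sigmaEval Λ Γ ω) q ≠ 0 ∧
      Λ w v * MvPolynomial.eval (sigmaEval Λ Γ ω) q
        = MvPolynomial.eval (sigmaEval Λ Γ ω) p

/-- The entry `Ω_{ij}` of the latent covariance matrix is rationally identifiable. -/
def OmegaIdent (DV : Finset (V × V)) (DLV : Finset (L × V)) (i j : V) : Prop :=
  ∃ (p q : MvPolynomial (V × V) ℝ) (g : MvPolynomial (ParamVar DV DLV) ℝ),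
    g ≠ 0 ∧
    ∀ (Λ : Matrix V V ℝ) (Γ : Matrix L V ℝ) (ω : V → ℝ),
      GoodParams DV DLV Λ Γ ω →
      MvPolynomial.eval (evalParam DV DLV Λ Γ ω) g ≠ 0 →
      MvPolynomial.eval (sigmaEval Λ Γ ω) q ≠ 0 ∧
      (Matrix.diagonal ω + Γᵀ * Γ) i j * MvPolynomial.eval (sigmaEval Λ Γ ω) q
        = MvPolynomial.eval (sigmaEval Λ Γ ω) p

end Matrices

end LFG

open LFG

/-- **Low rank structure of the latent covariance matrix.**
Under conditions (i)–(ii) of the LF-HTC, the submatrix `Ω_{Y, Z ∪ {v}}` of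
`Ω = Ω_diag + ΓᵀΓ` equals `∑_{h ∈ H} (Γ_h^⊤ Γ_h)_{Y, Z ∪ {v}}`; in particular it has
rank at most `|H| = |Z|` and hence does not have full column rank. -/
theorem omega_submatrix_low_rank
    {V L : Type} [Fintype V] [DecidableEq V] [Fintype L] [DecidableEq L]
    (DV : Finset (V × V)) (DLV : Finset (L × V))
    (hloop : ∀ x : V, (x, x) ∉ DV)
    (v : V) (Y Z : Finset V) (H : Finset L)
    (hvY : v ∉ Y) (hvZ : v ∉ Z)
    (hcard : H.card = Z.card)
    (hdisj : Disjoint Y (insert v Z))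
    (hpa : paL DLV Y ∩ paL DLV (insert v Z) ⊆ H)
    (Γ : Matrix L V ℝ) (ω : V → ℝ)
    (hΓ : ∀ h a, (h, a) ∉ DLV → Γ h a = 0)
    (hω : ∀ a, 0 < ω a) :
    (∀ y ∈ Y, ∀ z ∈ insert v Z,
      (Matrix.diagonal ω + Γᵀ * Γ) y z = ∑ h ∈ H, Γ h y * Γ h z) ∧
    (Matrix.of fun (y : ↑Y) (z : ↑(insert v Z)) =>
      (Matrix.diagonal ω + Γᵀ * Γ) y.1 z.1).rank ≤ H.card ∧
    (Matrix.of fun (y : ↑Y) (z : ↑(insert v Z)) =>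
      (Matrix.diagonal ω + Γᵀ * Γ) y.1 z.1).rank < (insert v Z).card := by
  have key : ∀ y ∈ Y, ∀ z ∈ insert v Z,
      (Matrix.diagonal ω + Γᵀ * Γ) y z = ∑ h ∈ H, Γ h y * Γ h z := by
    intro y hy z hz
    have hne : y ≠ z := fun h => Finset.disjoint_left.mp hdisj hy (h ▸ hz)
    rw [Matrix.add_apply, Matrix.diagonal_apply_ne _ hne, zero_add, Matrix.mul_apply]
    simp only [Matrix.transpose_apply]
    refine (Finset.sum_subset (Finset.subset_univ H) fun h _ hh => ?_).symm
    by_contra hprod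
    obtain ⟨h₁, h₂⟩ := mul_ne_zero_iff.mp hprod
    have mem_paL : ∀ (W : Finset V) (a : V), a ∈ W → Γ h a ≠ 0 → h ∈ paL DLV W :=
      fun W a ha hne => Finset.mem_image.mpr
        ⟨(h, a), Finset.mem_filter.mpr ⟨by_contra fun hn => hne (hΓ h a hn), ha⟩, rfl⟩
    exact hh (hpa (Finset.mem_inter.mpr ⟨mem_paL Y y hy h₁, mem_paL _ z hz h₂⟩))
  have hrank : (Matrix.of fun (y : ↑Y) (z : ↑(insert v Z)) =>
      (Matrix.diagonal ω + Γᵀ * Γ) y.1 z.1).rank ≤ H.card := by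
    have hfac : (Matrix.of fun (y : ↑Y) (z : ↑(insert v Z)) =>
        (Matrix.diagonal ω + Γᵀ * Γ) y.1 z.1) =
        (Matrix.of fun (y : ↑Y) (h : ↑H) => Γ h.1 y.1) *
          (Matrix.of fun (h : ↑H) (z : ↑(insert v Z)) => Γ h.1 z.1) := by
      ext y z
      rw [Matrix.of_apply, key y.1 y.2 z.1 z.2, Matrix.mul_apply]
      exact (Finset.sum_coe_sort H fun h => Γ h y.1 * Γ h z.1).symm
    rw [hfac]
    refine (Matrix.rank_mul_le_left _ _).trans ((Matrix.rank_le_card_width _).trans ?_)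
    rw [Fintype.card_coe]
  refine ⟨key, hrank, hrank.trans_lt ?_⟩
  rw [Finset.card_insert_of_notMem hvZ, hcard]
  exact Nat.lt_succ_self _
end

section
/- Let G = (V ∪ ℒ, D) be a latent-factor graph, let v ∈ V, and suppose the triple (Y, Z, H) satisfies conditions (i) and (ii) of the latent-factor half-trek criterion with respect to v, with pa_V(v) = {p_1, …, p_n}, Y = {y_1, …, y_{n+r}}, Z = {z_1, …, z_r}, and r = |H|. Fix parameters (Λ, Γ, Ω_diag) ∈ ℝ^{D_V}_reg × ℝ^{D_{ℒV}} × diag⁺_d, set Ω = Ω_diag + Γ^⊤Γ, Σ = (I_d − Λ)^{−⊤} Ω (I_d − Λ)^{−1} and Ω_H = Σ_{h∈H} Γ_h^⊤Γ_h, and define the matrices A, B and vector c as in the context. If the d × r matrix (Ω_H)_{V,Z} has full column rank r, then there exists ψ ∈ ℝ^r such that A · Λ_{pa_V(v), v} + B · ψ = c, where Λ_{pa_V(v), v} = (λ_{p_1 v}, …, λ_{p_n v})^⊤. -/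
open scoped Classical
open Matrix

namespace LFG

variable {V L : Type} [Fintype V] [DecidableEq V] [Fintype L] [DecidableEq L]

/-- The matrix `A` from the proof of the main theorem. -/
noncomputable def matA (DV : Finset (V × V)) (DLV : Finset (L × V))
    (v : V) (Z : Finset V) (H : Finset L)
    (Λ : Matrix V V ℝ) (Γ : Matrix L V ℝ) (ω : V → ℝ)
    {n r : ℕ} (p : Fin n → V) (y : Fin (n + r) → V) :
    Matrix (Fin (n + r)) (Fin n) ℝ :=
  Matrix.of fun i j =>
    if HtrReach DV DLV H (insert v Z) (y i)
    then (((1 - Λ)ᵀ * SigmaMat Λ Γ ω : Matrix V V ℝ)) (y i) (p j)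
    else SigmaMat Λ Γ ω (y i) (p j)

/-- The matrix `B` from the proof of the main theorem. -/
noncomputable def matB (DV : Finset (V × V)) (DLV : Finset (L × V))
    (v : V) (Z : Finset V) (H : Finset L)
    (Λ : Matrix V V ℝ) (Γ : Matrix L V ℝ) (ω : V → ℝ)
    {n r : ℕ} (z : Fin r → V) (y : Fin (n + r) → V) :
    Matrix (Fin (n + r)) (Fin r) ℝ :=
  Matrix.of fun i j =>
    if HtrReach DV DLV H (insert v Z) (y i)
    then (((1 - Λ)ᵀ * SigmaMat Λ Γ ω * (1 - Λ) : Matrix V V ℝ)) (y i) (z j)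
    else ((SigmaMat Λ Γ ω * (1 - Λ) : Matrix V V ℝ)) (y i) (z j)

/-- The vector `c` from the proof of the main theorem. -/
noncomputable def vecC (DV : Finset (V × V)) (DLV : Finset (L × V))
    (v : V) (Z : Finset V) (H : Finset L)
    (Λ : Matrix V V ℝ) (Γ : Matrix L V ℝ) (ω : V → ℝ)
    {n r : ℕ} (y : Fin (n + r) → V) : Fin (n + r) → ℝ :=
  fun i =>
    if HtrReach DV DLV H (insert v Z) (y i)
    then (((1 - Λ)ᵀ * SigmaMat Λ Γ ω : Matrix V V ℝ)) (y i) v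
    else SigmaMat Λ Γ ω (y i) v

end LFG

namespace LFG

section HalfTreks

variable {V L : Type*} {DV : Finset (V × V)} {DLV : Finset (L × V)} {H : Finset L}

/-- A directed path from `w` to `y ≠ w` is a half-trek without latent node. -/
theorem HtrFrom.of_reflTransGen {w y : V} (hne : w ≠ y)
    (h : Relation.ReflTransGen (fun a b => (a, b) ∈ DV) w y) : HtrFrom DV DLV H w y := by
  obtain ⟨l, hl, hlast⟩ := List.exists_isChain_cons_of_relationReflTransGen h
  refine ⟨hne, ⟨w, none, l, hl.tail, fun _ x hx => ?_, by simp, by simp⟩, rfl, ?_,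
    by simp [HalfTrek.Avoids]⟩
  · exact (List.isChain_cons.mp hl).1 x hx
  · simpa [HalfTrek.target, List.getLast_eq_getLastD] using hlast

/-- An edge `w ← h → x` with `h ∉ H` followed by a directed path from `x` to `y ≠ w`
is a half-trek avoiding `H`. -/
theorem HtrFrom.of_latent {w x y : V} {h : L} (hne : w ≠ y) (hH : h ∉ H)
    (hw : (h, w) ∈ DLV) (hx : (h, x) ∈ DLV)
    (hxy : Relation.ReflTransGen (fun a b => (a, b) ∈ DV) x y) : HtrFrom DV DLV H w y := by
  obtain ⟨l, hl, hlast⟩ := List.exists_isChain_cons_of_relationReflTransGen hxy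
  refine ⟨hne, ⟨w, some h, x :: l, hl, by simp, ?_, ?_⟩, rfl, ?_, ?_⟩
  · rintro _ ⟨⟩
    exact hw
  · rintro _ ⟨⟩
    exact ⟨x, rfl, hx⟩
  · rw [← hlast, HalfTrek.target, List.getLastD_cons, List.getLast_eq_getLastD]
  · rintro _ ⟨⟩
    exact hH

end HalfTreks

/-- If `Λ` is supported on the edges of a directed graph, then `(1 - Λ)⁻¹` is supported on the
pairs connected by a directed path. -/
theorem inv_one_sub_apply_eq_zero {V : Type*} [Fintype V] [DecidableEq V]
    {DV : Finset (V × V)} {Λ : Matrix V V ℝ} (hΛ : ∀ a b, (a, b) ∉ DV → Λ a b = 0)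
    (hunit : IsUnit (1 - Λ)) {x y : V}
    (hxy : ¬ Relation.ReflTransGen (fun a b => (a, b) ∈ DV) x y) : (1 - Λ)⁻¹ x y = 0 := by
  let b : V → ℕ := fun a =>
    if Relation.ReflTransGen (fun a b => (a, b) ∈ DV) a y then 0 else 1
  have htri : (1 - Λ).BlockTriangular b := by
    intro i j hij
    by_cases hi : Relation.ReflTransGen (fun a b => (a, b) ∈ DV) i y
    · simp [b, hi] at hij
    by_cases hj : Relation.ReflTransGen (fun a b => (a, b) ∈ DV) j y
    · have hne : i ≠ j := fun h => hi (h ▸ hj)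
      rw [Matrix.sub_apply, Matrix.one_apply_ne hne, hΛ i j fun hmem => hi (hj.head hmem),
        sub_zero]
    · simp [b, hi, hj] at hij
  let := hunit.invertible
  refine Matrix.blockTriangular_inv_of_blockTriangular htri ?_
  simp [b, hxy, Relation.ReflTransGen.refl]

section LatentCovariance

variable {V L : Type*} {DV : Finset (V × V)} {DLV : Finset (L × V)}

/-- The part `Ω_H = ∑_{h ∈ H} Γ_h^⊤ Γ_h` of the latent covariance matrix due to `H`. -/
def latentCov (Γ : Matrix L V ℝ) (H : Finset L) : Matrix V V ℝ :=
  Matrix.of fun a b => ∑ h ∈ H, Γ h a * Γ h b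

/-- A nonzero entry of `latentCov Γ H` is witnessed by a common latent parent in `H`. -/
theorem exists_common_parent_of_latentCov_ne_zero {Γ : Matrix L V ℝ}
    (hΓ : ∀ h a, (h, a) ∉ DLV → Γ h a = 0) {H : Finset L} {a b : V}
    (hab : latentCov Γ H a b ≠ 0) : ∃ h ∈ H, (h, a) ∈ DLV ∧ (h, b) ∈ DLV := by
  obtain ⟨h, hH, hne⟩ := Finset.exists_ne_zero_of_sum_ne_zero hab
  refine ⟨h, hH, ?_, ?_⟩
  · by_contra hc
    exact hne (by rw [hΓ h a hc, zero_mul])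
  · by_contra hc
    exact hne (by rw [hΓ h b hc, mul_zero])

/-- If the columns `z` of `latentCov Γ H` have full rank `H.card`, they span every column. -/
theorem exists_sum_latentCov_eq [Fintype V] (Γ : Matrix L V ℝ) {H : Finset L} {r : ℕ}
    (hr : H.card = r) (z : Fin r → V)
    (hrank : (Matrix.of fun (a : V) (j : Fin r) => latentCov Γ H a (z j)).rank = r) (v : V) :
    ∃ ψ : Fin r → ℝ, ∀ x, ∑ j, latentCov Γ H x (z j) * ψ j = latentCov Γ H x v := by
  let P : Matrix V H ℝ := Matrix.of fun a h => Γ h a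
  let Q : Matrix H (Fin r) ℝ := Matrix.of fun h j => Γ h (z j)
  have hcov (a b : V) : latentCov Γ H a b = ∑ h : H, Γ h a * Γ h b :=
    (Finset.sum_coe_sort H fun h => Γ h a * Γ h b).symm
  have hPQ : (Matrix.of fun (a : V) (j : Fin r) => latentCov Γ H a (z j)) = P * Q := by
    ext a j
    simp [P, Q, Matrix.mul_apply, hcov]
  have hQ : Q.rank = r := by
    refine le_antisymm (by simpa using Q.rank_le_card_width) ?_
    calc r = (P * Q).rank := by rw [← hPQ, hrank]
      _ ≤ Q.rank := Matrix.rank_mul_le_right P Q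
  have htop : LinearMap.range Q.mulVecLin = ⊤ := by
    apply Submodule.eq_top_of_finrank_eq
    rw [Module.finrank_fintype_fun_eq_card, Fintype.card_coe, hr]
    exact hQ
  obtain ⟨ψ, hψ⟩ := LinearMap.range_eq_top.mp htop fun h : H => Γ h v
  have hψ' : Q *ᵥ ψ = fun h : H => Γ h v := hψ
  refine ⟨ψ, fun x => ?_⟩
  calc ∑ j, latentCov Γ H x (z j) * ψ j = ((P * Q) *ᵥ ψ) x := by
        rw [← hPQ]
        rfl
    _ = latentCov Γ H x v := by
        rw [← Matrix.mulVec_mulVec, hψ', hcov]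
        rfl

variable [DecidableEq V] [Fintype L] [DecidableEq L]

theorem diagonal_add_gram_eq (Γ : Matrix L V ℝ) (ω : V → ℝ) (H : Finset L) :
    Matrix.diagonal ω + Γᵀ * Γ =
      (Matrix.diagonal ω + latentCov Γ Hᶜ) + latentCov Γ H := by
  rw [add_assoc]
  congr 1
  ext a b
  simp [latentCov, Matrix.mul_apply, Finset.sum_compl_add_sum]

/-- If the latent parents shared by `a` and `b ≠ a` all lie in `H`, then the residual covariance
after removing the contribution of `H` vanishes. -/
theorem residual_apply_eq_zero {Γ : Matrix L V ℝ} (ω : V → ℝ)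
    (hΓ : ∀ h a, (h, a) ∉ DLV → Γ h a = 0) {H : Finset L} {a b : V} (hne : a ≠ b)
    (hpa : ∀ h, (h, a) ∈ DLV → (h, b) ∈ DLV → h ∈ H) :
    (Matrix.diagonal ω + latentCov Γ Hᶜ) a b = 0 := by
  rw [Matrix.add_apply, Matrix.diagonal_apply_ne _ hne, zero_add]
  by_contra hc
  obtain ⟨h, hH, ha, hb⟩ := exists_common_parent_of_latentCov_ne_zero hΓ hc
  exact Finset.mem_compl.mp hH (hpa h ha hb)

/-- The residual covariance propagated along directed paths vanishes at `(y, w)` when `y` is not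
half-trek reachable from `w` while avoiding `H`. -/
theorem inv_mul_residual_apply_eq_zero [Fintype V] {Λ : Matrix V V ℝ} {Γ : Matrix L V ℝ}
    {ω : V → ℝ} (hGood : GoodParams DV DLV Λ Γ ω) {H : Finset L} {w y : V} (hne : w ≠ y)
    (hreach : ¬ HtrFrom DV DLV H w y) :
    (((1 - Λ)ᵀ)⁻¹ * (Matrix.diagonal ω + latentCov Γ Hᶜ) : Matrix V V ℝ) y w = 0 := by
  obtain ⟨hΛ, hunit, hΓ, -⟩ := hGood
  rw [← Matrix.transpose_nonsing_inv, Matrix.mul_apply]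
  refine Finset.sum_eq_zero fun x _ => ?_
  rw [Matrix.transpose_apply]
  by_cases hxy : Relation.ReflTransGen (fun a b => (a, b) ∈ DV) x y
  · rcases eq_or_ne x w with rfl | hxw
    · exact absurd (HtrFrom.of_reflTransGen hne hxy) hreach
    · rw [residual_apply_eq_zero ω hΓ hxw, mul_zero]
      intro h hx hw
      by_contra hH
      exact hreach (HtrFrom.of_latent hne hH hw hx hxy)
  · rw [inv_one_sub_apply_eq_zero hΛ hunit hxy, zero_mul]

end LatentCovariance

/-- Multiplying by column `v` of `1 - Λ` only involves the parents of `v`. -/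
theorem sum_parents_eq_sub {V : Type*} [Fintype V] [DecidableEq V] {DV : Finset (V × V)}
    {Λ : Matrix V V ℝ} (hΛ : ∀ a b, (a, b) ∉ DV → Λ a b = 0) {v : V} {n : ℕ}
    {p : Fin n → V} (hpinj : Function.Injective p)
    (hpim : Finset.image p Finset.univ = paV DV v) (X : Matrix V V ℝ) (a : V) :
    ∑ j, X a (p j) * Λ (p j) v = X a v - (X * (1 - Λ)) a v := by
  have hsum : ∑ j, X a (p j) * Λ (p j) v = (X * Λ) a v := by
    rw [Matrix.mul_apply, ← Finset.sum_image (g := p) (f := fun w => X a w * Λ w v)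
      hpinj.injOn]
    refine Finset.sum_subset (Finset.subset_univ _) fun w _ hw => ?_
    rw [hΛ w v, mul_zero]
    intro hmem
    rw [hpim] at hw
    exact hw (Finset.mem_image.mpr ⟨(w, v), Finset.mem_filter.mpr ⟨hmem, rfl⟩, rfl⟩)
  rw [hsum, Matrix.mul_sub, Matrix.mul_one, Matrix.sub_apply, sub_sub_cancel]

/-- If columns `z` of `C` combine to column `v` with coefficients `ψ`, and row `a` of `K * R`
vanishes on those columns, then row `a` of `K * (R + C)` satisfies the same relation. -/
theorem sum_mul_add_apply_eq {V : Type*} [Fintype V] {r : ℕ} {z : Fin r → V} {v : V}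
    {C : Matrix V V ℝ} {ψ : Fin r → ℝ} (hψ : ∀ x, ∑ j, C x (z j) * ψ j = C x v)
    {K R : Matrix V V ℝ} {a : V} (hv : (K * R) a v = 0) (hz : ∀ j, (K * R) a (z j) = 0) :
    ∑ j, (K * (R + C)) a (z j) * ψ j = (K * (R + C)) a v := by
  simp only [Matrix.mul_add, Matrix.add_apply, hv, hz, zero_add]
  simp only [Matrix.mul_apply, Finset.sum_mul, mul_assoc]
  rw [Finset.sum_comm]
  simp only [← Finset.mul_sum, hψ]

end LFG

open LFG

/-- **Claim 2 in the proof of the main theorem.**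
Under conditions (i)–(ii) of the LF-HTC, if `(Ω_H)_{V,Z}` has full column rank `r`,
then there is `ψ ∈ ℝ^r` with `A · Λ_{pa_V(v),v} + B · ψ = c`. -/
theorem exists_psi_solving_linear_system
    {V L : Type} [Fintype V] [DecidableEq V] [Fintype L] [DecidableEq L]
    (DV : Finset (V × V)) (DLV : Finset (L × V))
    (hloop : ∀ x : V, (x, x) ∉ DV)
    (v : V) (Y Z : Finset V) (H : Finset L)
    (n r : ℕ)
    (p : Fin n → V) (y : Fin (n + r) → V) (z : Fin r → V)
    (hpinj : Function.Injective p) (hyinj : Function.Injective y)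
    (hzinj : Function.Injective z)
    (hpim : Finset.image p Finset.univ = paV DV v)
    (hyim : Finset.image y Finset.univ = Y)
    (hzim : Finset.image z Finset.univ = Z)
    (hr : H.card = r)
    -- conditions (i) and (ii) of the LF-HTC
    (hvY : v ∉ Y) (hvZ : v ∉ Z)
    (hcardY : Y.card = (paV DV v).card + H.card)
    (hcardZ : Z.card = H.card)
    (hZpa : Disjoint Z (paV DV v))
    (hYdisj : Disjoint Y (insert v Z))
    (hpaL : paL DLV Y ∩ paL DLV (insert v Z) ⊆ H)
    -- parameters
    (Λ : Matrix V V ℝ) (Γ : Matrix L V ℝ) (ω : V → ℝ)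
    (hGood : GoodParams DV DLV Λ Γ ω)
    -- (Ω_H)_{V,Z} has full column rank r
    (hrank : (Matrix.of fun (a : V) (j : Fin r) =>
      ∑ h ∈ H, Γ h a * Γ h (z j)).rank = r) :
    ∃ ψ : Fin r → ℝ, ∀ i : Fin (n + r),
      (∑ j : Fin n, matA DV DLV v Z H Λ Γ ω p y i j * Λ (p j) v)
        + (∑ j : Fin r, matB DV DLV v Z H Λ Γ ω z y i j * ψ j)
        = vecC DV DLV v Z H Λ Γ ω y i := by
  obtain ⟨hΛ, hunit, hΓ, -⟩ := id hGood
  have hdet : IsUnit (1 - Λ).det := (Matrix.isUnit_iff_isUnit_det _).mp hunit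
  have hdetT : IsUnit (1 - Λ)ᵀ.det := by rwa [Matrix.det_transpose]
  have hSM : SigmaMat Λ Γ ω * (1 - Λ) = ((1 - Λ)ᵀ)⁻¹ * (Matrix.diagonal ω + Γᵀ * Γ) := by
    rw [SigmaMat, Matrix.nonsing_inv_mul_cancel_right _ _ hdet]
  have hMSM : (1 - Λ)ᵀ * SigmaMat Λ Γ ω * (1 - Λ) =
      1 * (Matrix.diagonal ω + Γᵀ * Γ) := by
    rw [Matrix.mul_assoc, hSM, Matrix.mul_nonsing_inv_cancel_left _ _ hdetT, Matrix.one_mul]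
  obtain ⟨ψ, hψ⟩ := exists_sum_latentCov_eq Γ hr z hrank v
  refine ⟨ψ, fun i => ?_⟩
  have hyY : y i ∈ Y := hyim ▸ Finset.mem_image_of_mem y (Finset.mem_univ i)
  have hzZ (j : Fin r) : z j ∈ insert v Z :=
    Finset.mem_insert_of_mem (hzim ▸ Finset.mem_image_of_mem z (Finset.mem_univ j))
  have hne {w : V} (hw : w ∈ insert v Z) : y i ≠ w := fun h =>
    Finset.disjoint_left.mp hYdisj hyY (h ▸ hw)
  by_cases hreach : HtrReach DV DLV H (insert v Z) (y i)
  · have hres {w : V} (hw : w ∈ insert v Z) :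
        (1 * (Matrix.diagonal ω + latentCov Γ Hᶜ) : Matrix V V ℝ) (y i) w = 0 := by
      rw [Matrix.one_mul]
      refine residual_apply_eq_zero ω hΓ (hne hw) fun h hy hw' => hpaL ?_
      refine Finset.mem_inter.mpr ⟨Finset.mem_image.mpr ⟨(h, y i), ?_, rfl⟩,
        Finset.mem_image.mpr ⟨(h, w), ?_, rfl⟩⟩
      · exact Finset.mem_filter.mpr ⟨hy, hyY⟩
      · exact Finset.mem_filter.mpr ⟨hw', hw⟩
    simp only [matA, matB, vecC, Matrix.of_apply, if_pos hreach]
    rw [sum_parents_eq_sub hΛ hpinj hpim, hMSM, diagonal_add_gram_eq Γ ω H,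
      sum_mul_add_apply_eq hψ (hres (Finset.mem_insert_self v Z)) fun j => hres (hzZ j),
      sub_add_cancel]
  · have hres {w : V} (hw : w ∈ insert v Z) :
        (((1 - Λ)ᵀ)⁻¹ * (Matrix.diagonal ω + latentCov Γ Hᶜ) : Matrix V V ℝ) (y i) w = 0 :=
      inv_mul_residual_apply_eq_zero hGood (hne hw).symm fun h => hreach ⟨w, hw, h⟩
    simp only [matA, matB, vecC, Matrix.of_apply, if_neg hreach]
    rw [sum_parents_eq_sub hΛ hpinj hpim, hSM, diagonal_add_gram_eq Γ ω H,
      sum_mul_add_apply_eq hψ (hres (Finset.mem_insert_self v Z)) fun j => hres (hzZ j),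
      sub_add_cancel]
end
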